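/- Let n ≥ 3 and let B_1, ..., B_m be real symmetric 3×3 matrices, each with trace zero. Then Σ_{r,s=1}^m ‖[B_r,B_s]‖² ≤ (Σ_{r=1}^m ‖B_r‖²)². (This is the case P(3,m) of the DDVV matrix inequality, proved by Choi and Lu.) -/

import Mathlib

open Matrix BigOperators

/-- Squared Frobenius norm of a real square matrix. -/
def frobSq {n : ℕ} (A : Matrix (Fin n) (Fin n) ℝ) : ℝ := ∑ i, ∑ j, (A i j) ^ 2

/-- Commutator of two square matrices. -/
def matComm {n : ℕ} (A B : Matrix (Fin n) (Fin n) ℝ) : Matrix (Fin n) (Fin n) ℝ :=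
  A * B - B * A

/-- Squared length is preserved by the transpose of a matrix with orthonormal rows. -/
lemma sum_sq_of_mul_transpose_eq_one {ι : Type*} [Fintype ι] [DecidableEq ι]
    {U : Matrix ι ι ℝ} (hU : U * Uᵀ = 1) (v : ι → ℝ) :
    ∑ a, (∑ r, U r a * v r) ^ 2 = ∑ r, v r ^ 2 := by
  have h1 : (Uᵀ *ᵥ v) ⬝ᵥ (Uᵀ *ᵥ v) = v ⬝ᵥ v := by
    rw [Matrix.dotProduct_mulVec, Matrix.vecMul_transpose, Matrix.mulVec_mulVec, hU,
      Matrix.one_mulVec]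
  simpa only [dotProduct, Matrix.mulVec, Matrix.transpose_apply, ← pow_two] using h1

/-- The spectral theorem for real symmetric matrices. -/
lemma exists_orthogonal_diagonalization {ι : Type*} [Fintype ι] [DecidableEq ι]
    (M : Matrix ι ι ℝ) (hM : Mᵀ = M) :
    ∃ (U : Matrix ι ι ℝ) (d : ι → ℝ),
      U * Uᵀ = 1 ∧ Uᵀ * U = 1 ∧ M = U * Matrix.diagonal d * Uᵀ := by
  have hH : M.IsHermitian := by
    rw [Matrix.IsHermitian, Matrix.conjTranspose_eq_transpose_of_trivial, hM]
  refine ⟨hH.eigenvectorUnitary, hH.eigenvalues, ?_, ?_, ?_⟩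
  · simpa [Matrix.star_eq_conjTranspose] using Unitary.coe_mul_star_self hH.eigenvectorUnitary
  · simpa [Matrix.star_eq_conjTranspose] using Unitary.coe_star_mul_self hH.eigenvectorUnitary
  · have h := hH.spectral_theorem
    simpa [Unitary.conjStarAlgAut_apply, Matrix.star_eq_conjTranspose, Function.comp_def] using h

lemma frobSq_eq_trace {n : ℕ} (A : Matrix (Fin n) (Fin n) ℝ) :
    frobSq A = Matrix.trace (Aᵀ * A) := by
  simp only [frobSq, Matrix.trace, Matrix.diag, Matrix.mul_apply, Matrix.transpose_apply]
  rw [Finset.sum_comm]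
  simp only [pow_two]

lemma frobSq_nonneg {n : ℕ} (A : Matrix (Fin n) (Fin n) ℝ) : 0 ≤ frobSq A :=
  Finset.sum_nonneg fun _ _ => Finset.sum_nonneg fun _ _ => sq_nonneg _

lemma frobSq_smul {n : ℕ} (c : ℝ) (A : Matrix (Fin n) (Fin n) ℝ) :
    frobSq (c • A) = c ^ 2 * frobSq A := by
  simp [frobSq, Finset.mul_sum, mul_pow]

lemma eq_zero_of_frobSq_eq_zero {n : ℕ} {A : Matrix (Fin n) (Fin n) ℝ} (h : frobSq A = 0) :
    A = 0 := by
  ext i j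
  have h1 := (Finset.sum_eq_zero_iff_of_nonneg
    (fun i _ => Finset.sum_nonneg fun j _ => sq_nonneg (A i j))).1 h i (Finset.mem_univ i)
  have h2 := (Finset.sum_eq_zero_iff_of_nonneg
    (fun j _ => sq_nonneg (A i j))).1 h1 j (Finset.mem_univ j)
  simpa using h2

lemma frobSq_orthogonal_conj {n : ℕ} {U : Matrix (Fin n) (Fin n) ℝ} (hU : Uᵀ * U = 1)
    (X : Matrix (Fin n) (Fin n) ℝ) : frobSq (U * X * Uᵀ) = frobSq X := by
  rw [frobSq_eq_trace, frobSq_eq_trace]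
  have h : (U * X * Uᵀ)ᵀ * (U * X * Uᵀ) = U * (Xᵀ * X * Uᵀ) := by
    calc (U * X * Uᵀ)ᵀ * (U * X * Uᵀ) = U * (Xᵀ * ((Uᵀ * U) * (X * Uᵀ))) := by
          simp only [Matrix.transpose_mul, Matrix.transpose_transpose, Matrix.mul_assoc]
      _ = _ := by rw [hU, Matrix.one_mul, Matrix.mul_assoc]
  rw [h, Matrix.trace_mul_comm, Matrix.mul_assoc, hU, Matrix.mul_one]

lemma frobSq_matComm_swap {n : ℕ} (A B : Matrix (Fin n) (Fin n) ℝ) :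
    frobSq (matComm A B) = frobSq (matComm B A) := by
  have h : matComm A B = (-1 : ℝ) • matComm B A := by simp [matComm]
  rw [h, frobSq_smul]
  norm_num

lemma matComm_smul_smul {n : ℕ} (a b : ℝ) (A B : Matrix (Fin n) (Fin n) ℝ) :
    matComm (a • A) (b • B) = (a * b) • matComm A B := by
  simp only [matComm, Matrix.smul_mul, Matrix.mul_smul, smul_smul, smul_sub, mul_comm]

/-- The Böttcher–Wenzel inequality with a symmetric first entry. -/
lemma frobSq_matComm_le {n : ℕ} {A : Matrix (Fin n) (Fin n) ℝ} (hA : Aᵀ = A)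
    (B : Matrix (Fin n) (Fin n) ℝ) :
    frobSq (matComm A B) ≤ 2 * frobSq A * frobSq B := by
  obtain ⟨U, d, hU, hU', rfl⟩ := exists_orthogonal_diagonalization A hA
  have hB : B = U * (Uᵀ * B * U) * Uᵀ := by
    calc B = (U * Uᵀ) * B * (U * Uᵀ) := by rw [hU, Matrix.one_mul, Matrix.mul_one]
      _ = _ := by simp only [Matrix.mul_assoc]
  generalize Uᵀ * B * U = C at hB
  subst hB
  have hprod : ∀ X Y : Matrix (Fin n) (Fin n) ℝ,
      (U * X * Uᵀ) * (U * Y * Uᵀ) = U * (X * Y) * Uᵀ := by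
    intro X Y
    calc (U * X * Uᵀ) * (U * Y * Uᵀ) = U * X * (Uᵀ * U) * Y * Uᵀ := by
          simp only [Matrix.mul_assoc]
      _ = _ := by rw [hU', Matrix.mul_one]; simp only [Matrix.mul_assoc]
  have hcomm : matComm (U * Matrix.diagonal d * Uᵀ) (U * C * Uᵀ)
      = U * matComm (Matrix.diagonal d) C * Uᵀ := by
    simp only [matComm, hprod, Matrix.mul_sub, Matrix.sub_mul]
  rw [hcomm, frobSq_orthogonal_conj hU', frobSq_orthogonal_conj hU', frobSq_orthogonal_conj hU']
  have hd : frobSq (Matrix.diagonal d) = ∑ i, d i ^ 2 := by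
    simp [frobSq, Matrix.diagonal_apply]
  rw [hd]
  simp only [frobSq, Finset.mul_sum]
  refine Finset.sum_le_sum fun i _ => Finset.sum_le_sum fun j _ => ?_
  have hentry : matComm (Matrix.diagonal d) C i j = (d i - d j) * C i j := by
    simp [matComm, Matrix.diagonal_mul, Matrix.mul_diagonal]
    ring
  rw [hentry, mul_pow, ← Finset.mul_sum]
  refine mul_le_mul_of_nonneg_right ?_ (sq_nonneg _)
  rcases eq_or_ne i j with rfl | hij
  · have : 0 ≤ ∑ k, d k ^ 2 := Finset.sum_nonneg fun _ _ => sq_nonneg _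
    simpa using this
  · have h : ∑ k ∈ {i, j}, d k ^ 2 ≤ ∑ k, d k ^ 2 :=
      Finset.sum_le_sum_of_subset_of_nonneg (Finset.subset_univ _) fun _ _ _ => sq_nonneg _
    rw [Finset.sum_pair hij] at h
    nlinarith [sq_nonneg (d i + d j)]

/-- Bessel's inequality for an orthogonal family of vectors of length at most one. -/
lemma sum_sq_le_of_orthogonal {ι κ : Type*} [Fintype ι] [Fintype κ]
    (e : ι → κ → ℝ) (horth : ∀ a b, a ≠ b → ∑ k, e a k * e b k = 0)
    (hnorm : ∀ a, ∑ k, e a k ^ 2 ≤ 1) (S : κ → ℝ) :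
    ∑ a, (∑ k, e a k * S k) ^ 2 ≤ ∑ k, S k ^ 2 := by
  classical
  set c : ι → ℝ := fun a => ∑ k, e a k * S k with hc
  have hcross : ∑ k, S k * ∑ a, c a * e a k = ∑ a, c a ^ 2 := by
    simp only [Finset.mul_sum]
    rw [Finset.sum_comm]
    refine Finset.sum_congr rfl fun a _ => ?_
    rw [pow_two]
    nth_rewrite 3 [hc]
    simp only [Finset.mul_sum]
    exact Finset.sum_congr rfl fun k _ => by ring
  have hsq : ∑ k, (∑ a, c a * e a k) ^ 2 = ∑ a, c a ^ 2 * ∑ k, e a k ^ 2 := by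
    simp only [pow_two (∑ a, c a * e a _), Finset.sum_mul_sum]
    rw [Finset.sum_comm]
    refine Finset.sum_congr rfl fun a _ => ?_
    rw [Finset.sum_comm]
    have hterm : ∀ b, ∑ k, c a * e a k * (c b * e b k) = c a * c b * ∑ k, e a k * e b k := by
      intro b
      rw [Finset.mul_sum]
      exact Finset.sum_congr rfl fun k _ => by ring
    simp only [hterm]
    rw [Finset.sum_eq_single a]
    · simp only [pow_two]
    · intro b _ hb
      rw [horth a b hb.symm, mul_zero]
    · simp
  have hle : ∑ a, c a ^ 2 * ∑ k, e a k ^ 2 ≤ ∑ a, c a ^ 2 :=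
    Finset.sum_le_sum fun a _ => mul_le_of_le_one_right (sq_nonneg _) (hnorm a)
  have hpos : 0 ≤ ∑ k, (S k - ∑ a, c a * e a k) ^ 2 := Finset.sum_nonneg fun _ _ => sq_nonneg _
  have hexp : ∑ k, (S k - ∑ a, c a * e a k) ^ 2
      = ∑ k, S k ^ 2 - 2 * ∑ k, S k * ∑ a, c a * e a k + ∑ k, (∑ a, c a * e a k) ^ 2 := by
    rw [Finset.mul_sum, ← Finset.sum_sub_distrib, ← Finset.sum_add_distrib]
    exact Finset.sum_congr rfl fun k _ => by ring
  linarith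

/-- For a traceless symmetric `3 × 3` matrix `A`, the quadratic form `X ↦ ‖[A, X]‖²` on
symmetric matrices has trace `3 ‖A‖²`. -/
lemma sum_frobSq_matComm_le {ι : Type*} [Fintype ι] {A : Matrix (Fin 3) (Fin 3) ℝ}
    (hA : Aᵀ = A) (htr : Matrix.trace A = 0) (e : ι → Matrix (Fin 3) (Fin 3) ℝ)
    (hsymm : ∀ a, (e a)ᵀ = e a)
    (horth : ∀ a b, a ≠ b → ∑ i, ∑ j, e a i j * e b i j = 0)
    (hnorm : ∀ a, frobSq (e a) ≤ 1) :
    ∑ a, frobSq (matComm A (e a)) ≤ 3 * frobSq A := by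
  let K : Fin 3 → Matrix (Fin 3) (Fin 3) ℝ :=
    ![!![0, 1, 0; -1, 0, 0; 0, 0, 0], !![0, 0, 1; 0, 0, 0; -1, 0, 0],
      !![0, 0, 0; 0, 0, 1; 0, -1, 0]]
  have bessel : ∀ p, ∑ a, (∑ i, ∑ j, e a i j * matComm A (K p) i j) ^ 2
      ≤ frobSq (matComm A (K p)) := by
    intro p
    have h := sum_sq_le_of_orthogonal (fun a (k : Fin 3 × Fin 3) => e a k.1 k.2)
      (by simpa only [Fintype.sum_prod_type] using horth)
      (by simpa only [frobSq, Fintype.sum_prod_type] using hnorm)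
      (fun k => matComm A (K p) k.1 k.2)
    simpa only [frobSq, Fintype.sum_prod_type] using h
  have h10 : A 1 0 = A 0 1 := congrFun (congrFun hA 0) 1
  have h20 : A 2 0 = A 0 2 := congrFun (congrFun hA 0) 2
  have h21 : A 2 1 = A 1 2 := congrFun (congrFun hA 1) 2
  have h22 : A 2 2 = -A 0 0 - A 1 1 := by
    rw [Matrix.trace_fin_three] at htr
    linarith
  have expand : ∀ a, frobSq (matComm A (e a))
      = 1 / 2 * ∑ p, (∑ i, ∑ j, e a i j * matComm A (K p) i j) ^ 2 := by
    intro a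
    have e10 : e a 1 0 = e a 0 1 := congrFun (congrFun (hsymm a) 0) 1
    have e20 : e a 2 0 = e a 0 2 := congrFun (congrFun (hsymm a) 0) 2
    have e21 : e a 2 1 = e a 1 2 := congrFun (congrFun (hsymm a) 1) 2
    simp [K, frobSq, matComm, Fin.sum_univ_three, Matrix.mul_apply, h10, h20, h21,
      e10, e20, e21]
    ring
  have total : 1 / 2 * ∑ p, frobSq (matComm A (K p)) = 3 * frobSq A := by
    simp [K, frobSq, matComm, Fin.sum_univ_three, Matrix.mul_apply, h10, h20, h21, h22]
    ring
  simp only [expand]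
  rw [← Finset.mul_sum, Finset.sum_comm, ← total]
  exact mul_le_mul_of_nonneg_left (Finset.sum_le_sum fun p _ => bessel p) (by norm_num)

/-- A symmetric form is nonnegative on nonnegative vectors as soon as each of its principal
submatrices has nonnegative row sums. -/
lemma sum_mul_mul_nonneg_of_row_sums_nonneg {ι : Type*} [DecidableEq ι] (q : ι → ι → ℝ)
    (hq : ∀ a b, q a b = q b a)
    (hrow : ∀ S : Finset ι, ∀ a ∈ S, 0 ≤ ∑ b ∈ S, q a b)
    (S : Finset ι) (w : ι → ℝ) (hw : ∀ a ∈ S, 0 ≤ w a) :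
    0 ≤ ∑ a ∈ S, ∑ b ∈ S, q a b * w a * w b := by
  induction S using Finset.strongInduction generalizing w with
  | H S ih =>
    rcases S.eq_empty_or_nonempty with rfl | hne
    · simp
    obtain ⟨c, hc, hmin⟩ := S.exists_min_image w hne
    set v : ι → ℝ := fun a => w a - w c with hv
    have hv0 : ∀ a ∈ S, 0 ≤ v a := fun a ha => sub_nonneg.2 (hmin a ha)
    have hvc : v c = 0 := sub_self _
    have hrec := ih (S.erase c) (Finset.erase_ssubset hc) v
      fun a ha => hv0 a (Finset.mem_of_mem_erase ha)
    have hdrop : ∑ a ∈ S.erase c, ∑ b ∈ S.erase c, q a b * v a * v b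
        = ∑ a ∈ S, ∑ b ∈ S, q a b * v a * v b := by
      rw [Finset.sum_erase _ (by simp [hvc])]
      exact Finset.sum_congr rfl fun a _ => Finset.sum_erase _ (by simp [hvc])
    rw [hdrop] at hrec
    have hswap : ∑ a ∈ S, ∑ b ∈ S, q a b * v b = ∑ a ∈ S, ∑ b ∈ S, q a b * v a := by
      rw [Finset.sum_comm]
      exact Finset.sum_congr rfl fun a _ => Finset.sum_congr rfl fun b _ => by rw [hq]
    have hexp : ∑ a ∈ S, ∑ b ∈ S, q a b * w a * w b
        = ∑ a ∈ S, ∑ b ∈ S, q a b * v a * v b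
          + w c * ∑ a ∈ S, ∑ b ∈ S, q a b * v a + w c * ∑ a ∈ S, ∑ b ∈ S, q a b * v b
          + w c ^ 2 * ∑ a ∈ S, ∑ b ∈ S, q a b := by
      simp only [Finset.mul_sum, ← Finset.sum_add_distrib]
      exact Finset.sum_congr rfl fun a _ => Finset.sum_congr rfl fun b _ => by
        simp only [hv]; ring
    have hlin : 0 ≤ ∑ a ∈ S, ∑ b ∈ S, q a b * v a := by
      refine Finset.sum_nonneg fun a ha => ?_
      rw [← Finset.sum_mul]
      exact mul_nonneg (hrow S a ha) (hv0 a ha)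
    have hconst : 0 ≤ ∑ a ∈ S, ∑ b ∈ S, q a b := Finset.sum_nonneg fun a ha => hrow S a ha
    have hwc := hw c hc
    rw [hexp, hswap]
    positivity

/-- The inequality for pairwise orthogonal matrices. -/
lemma sum_frobSq_matComm_le_of_orthogonal {ι : Type*} [Fintype ι]
    (C : ι → Matrix (Fin 3) (Fin 3) ℝ) (hsymm : ∀ a, (C a)ᵀ = C a)
    (htr : ∀ a, Matrix.trace (C a) = 0)
    (horth : ∀ a b, a ≠ b → ∑ i, ∑ j, C a i j * C b i j = 0) :
    ∑ a, ∑ b, frobSq (matComm (C a) (C b)) ≤ (∑ a, frobSq (C a)) ^ 2 := by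
  classical
  set w : ι → ℝ := fun a => frobSq (C a) with hw
  have hw0 : ∀ a, 0 ≤ w a := fun a => frobSq_nonneg _
  set e : ι → Matrix (Fin 3) (Fin 3) ℝ := fun a => (√(w a))⁻¹ • C a with he
  have hCe : ∀ a, C a = √(w a) • e a := by
    intro a
    rcases eq_or_ne (w a) 0 with h | h
    · rw [eq_zero_of_frobSq_eq_zero h, h]
      simp
    · have : √(w a) ≠ 0 := (Real.sqrt_ne_zero (hw0 a)).2 h
      simp [he, smul_smul, this]
  have hesymm : ∀ a, (e a)ᵀ = e a := fun a => by simp [he, hsymm]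
  have hetr : ∀ a, Matrix.trace (e a) = 0 := fun a => by simp [he, htr]
  have henorm : ∀ a, frobSq (e a) ≤ 1 := by
    intro a
    simp only [he]
    rw [frobSq_smul, inv_pow, Real.sq_sqrt (hw0 a)]
    exact inv_mul_le_one
  have heorth : ∀ a b, a ≠ b → ∑ i, ∑ j, e a i j * e b i j = 0 := by
    intro a b hab
    have h : ∑ i, ∑ j, e a i j * e b i j
        = (√(w a))⁻¹ * (√(w b))⁻¹ * ∑ i, ∑ j, C a i j * C b i j := by
      simp only [Finset.mul_sum]
      exact Finset.sum_congr rfl fun i _ => Finset.sum_congr rfl fun j _ => by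
        simp only [he, Matrix.smul_apply, smul_eq_mul]; ring
    rw [h, horth a b hab, mul_zero]
  set x : ι → ι → ℝ := fun a b => frobSq (matComm (e a) (e b)) with hx
  have hx0 : ∀ a b, 0 ≤ x a b := fun a b => frobSq_nonneg _
  have hxself : ∀ a, x a a = 0 := fun a => by simp [hx, matComm, frobSq]
  have hx2 : ∀ a b, x a b ≤ 2 := by
    intro a b
    have h := frobSq_matComm_le (hesymm a) (e b)
    have ha := henorm a
    have hb := henorm b
    have h1 : frobSq (e a) * frobSq (e b) ≤ 1 := mul_le_one₀ ha (frobSq_nonneg _) hb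
    simp only [hx]
    linarith
  have hx3 : ∀ a, ∑ b, x a b ≤ 3 := by
    intro a
    have h := sum_frobSq_matComm_le (hesymm a) (hetr a) e hesymm heorth henorm
    have ha := henorm a
    simp only [hx]
    linarith
  have hrow : ∀ S : Finset ι, ∀ a ∈ S, 0 ≤ ∑ b ∈ S, (1 - x a b) := by
    intro S a ha
    have h1 : ∑ b ∈ S, x a b ≤ 3 :=
      (Finset.sum_le_sum_of_subset_of_nonneg (Finset.subset_univ S)
        fun b _ _ => hx0 a b).trans (hx3 a)
    have h2 : ∑ b ∈ S, x a b ≤ 2 * ((S.card : ℝ) - 1) := by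
      rw [← Finset.sum_erase S (hxself a)]
      refine (Finset.sum_le_card_nsmul _ _ 2 fun b _ => hx2 a b).trans_eq ?_
      rw [nsmul_eq_mul, Finset.cast_card_erase_of_mem ha, mul_comm]
    rw [Finset.sum_sub_distrib, Finset.sum_const, nsmul_eq_mul, mul_one]
    rcases le_or_gt 3 S.card with h | h
    · have : (3 : ℝ) ≤ S.card := by exact_mod_cast h
      linarith
    · have : (S.card : ℝ) ≤ 2 := by exact_mod_cast Nat.lt_succ_iff.1 h
      linarith
  have key := sum_mul_mul_nonneg_of_row_sums_nonneg (fun a b => 1 - x a b)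
    (fun a b => by simp only [hx, frobSq_matComm_swap (e a)]) hrow Finset.univ w
    fun a _ => hw0 a
  have hterm : ∀ a b, frobSq (matComm (C a) (C b)) = w a * w b - (1 - x a b) * w a * w b := by
    intro a b
    rw [hCe a, hCe b, matComm_smul_smul, frobSq_smul, mul_pow, Real.sq_sqrt (hw0 a),
      Real.sq_sqrt (hw0 b)]
    simp only [hx]
    ring
  simp only [hterm, Finset.sum_sub_distrib]
  rw [pow_two, Finset.sum_mul_sum]
  linarith

lemma sum_frobSq_matComm_rotate {n : ℕ} {ι : Type*} [Fintype ι] [DecidableEq ι]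
    {U : Matrix ι ι ℝ} (hU : U * Uᵀ = 1) (B : ι → Matrix (Fin n) (Fin n) ℝ)
    (X : Matrix (Fin n) (Fin n) ℝ) :
    ∑ a, frobSq (matComm (∑ r, U r a • B r) X) = ∑ r, frobSq (matComm (B r) X) := by
  have hlin : ∀ a i j, matComm (∑ r, U r a • B r) X i j
      = ∑ r, U r a * matComm (B r) X i j := by
    intro a i j
    simp only [matComm, Finset.sum_mul, Finset.mul_sum, ← Finset.sum_sub_distrib,
      Matrix.sum_apply, Matrix.smul_mul, Matrix.mul_smul, Matrix.sub_apply, Matrix.smul_apply,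
      smul_eq_mul, mul_sub]
  simp only [frobSq, hlin]
  rw [Finset.sum_comm]
  conv_rhs => rw [Finset.sum_comm]
  refine Finset.sum_congr rfl fun i _ => ?_
  rw [Finset.sum_comm]
  conv_rhs => rw [Finset.sum_comm]
  exact Finset.sum_congr rfl fun j _ => sum_sq_of_mul_transpose_eq_one hU _

lemma sum_frobSq_rotate {n : ℕ} {ι : Type*} [Fintype ι] [DecidableEq ι]
    {U : Matrix ι ι ℝ} (hU : U * Uᵀ = 1) (B : ι → Matrix (Fin n) (Fin n) ℝ) :
    ∑ a, frobSq (∑ r, U r a • B r) = ∑ r, frobSq (B r) := by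
  simp only [frobSq, Matrix.sum_apply, Matrix.smul_apply, smul_eq_mul]
  rw [Finset.sum_comm]
  conv_rhs => rw [Finset.sum_comm]
  refine Finset.sum_congr rfl fun i _ => ?_
  rw [Finset.sum_comm]
  conv_rhs => rw [Finset.sum_comm]
  exact Finset.sum_congr rfl fun j _ => sum_sq_of_mul_transpose_eq_one hU _

/-- Every finite family of matrices can be rotated into a pairwise orthogonal one. -/
lemma exists_orthogonal_rotation {n : ℕ} {ι : Type*} [Fintype ι] [DecidableEq ι]
    (B : ι → Matrix (Fin n) (Fin n) ℝ) :
    ∃ U : Matrix ι ι ℝ, U * Uᵀ = 1 ∧ ∀ a b, a ≠ b →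
      ∑ i, ∑ j, (∑ r, U r a • B r) i j * (∑ r, U r b • B r) i j = 0 := by
  let V : Matrix ι (Fin n × Fin n) ℝ := Matrix.of fun r k => B r k.1 k.2
  obtain ⟨U, d, hU, hU', hG⟩ := exists_orthogonal_diagonalization (V * Vᵀ)
    (by rw [Matrix.transpose_mul, Matrix.transpose_transpose])
  refine ⟨U, hU, fun a b hab => ?_⟩
  have hdiag : (Uᵀ * V) * (Uᵀ * V)ᵀ = Matrix.diagonal d := by
    calc (Uᵀ * V) * (Uᵀ * V)ᵀ = Uᵀ * (V * Vᵀ) * U := by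
          simp only [Matrix.transpose_mul, Matrix.transpose_transpose, Matrix.mul_assoc]
      _ = (Uᵀ * U) * Matrix.diagonal d * (Uᵀ * U) := by
          rw [hG]; simp only [Matrix.mul_assoc]
      _ = Matrix.diagonal d := by rw [hU', Matrix.one_mul, Matrix.mul_one]
  have h := congrFun (congrFun hdiag a) b
  rw [Matrix.diagonal_apply_ne _ hab, Matrix.mul_apply, Fintype.sum_prod_type] at h
  simpa only [Matrix.transpose_apply, Matrix.mul_apply, V, Matrix.of_apply, Matrix.sum_apply,
    Matrix.smul_apply, smul_eq_mul] using h

/-- The case `P(3, m)` of the DDVV matrix inequality (Choi–Lu): the inequality for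
traceless real symmetric `3 × 3` matrices. -/
theorem ddvv_P3m (n m : ℕ) (hn : 3 ≤ n)
    (B : Fin m → Matrix (Fin 3) (Fin 3) ℝ)
    (hsymm : ∀ r, (B r)ᵀ = B r)
    (htr : ∀ r, Matrix.trace (B r) = 0) :
    ∑ r, ∑ s, frobSq (matComm (B r) (B s)) ≤ (∑ r, frobSq (B r)) ^ 2 := by
  obtain ⟨U, hU, horth⟩ := exists_orthogonal_rotation B
  have h := sum_frobSq_matComm_le_of_orthogonal (fun a => ∑ r, U r a • B r)
    (fun a => by simp [Matrix.transpose_sum, hsymm])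
    (fun a => by simp [Matrix.trace_sum, htr]) horth
  rw [sum_frobSq_rotate hU, Finset.sum_comm] at h
  simp only [sum_frobSq_matComm_rotate hU] at h
  rw [Finset.sum_comm] at h
  simp only [frobSq_matComm_swap (B _) (∑ r, _ • B r), sum_frobSq_matComm_rotate hU] at h
  rwa [Finset.sum_comm] at h
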